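/- Let (a_k)_{k≥1} satisfy Σ_{k=1}^∞ |a_k| < ∞, let V(x) = Σ_{k=1}^∞ a_k e^{ikx}, and let n ≥ 3 be an integer. Then Δ(εV; 1/n²) = 2cos(2π/n) for every ε ∈ [0, 1]; in particular, Δ(V; 1/n²) = 2cos(2π/n). -/

import Mathlib

noncomputable section

/-- `ψ` is a (twice differentiable) solution of the Hill equation `-ψ'' + V ψ = z ψ` on `ℝ`. -/
def IsHillSolution (V : ℝ → ℂ) (z : ℂ) (ψ : ℝ → ℂ) : Prop :=
  Differentiable ℝ ψ ∧ Differentiable ℝ (deriv ψ) ∧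
    ∀ x : ℝ, -deriv (deriv ψ) x + V x * ψ x = z * ψ x

/-- Coefficients of the Floquet solution `∑ₖ pₖ e^{i(k+μ)x}` for the potential
`∑ₖ bₖ e^{i(k+1)x}` at energy `μ²`, normalised by `p₀ = 1`. -/
def floquetCoeff (b : ℕ → ℂ) (μ : ℝ) : ℕ → ℂ
  | 0 => 1
  | m + 1 => -(∑ j : Fin (m + 1), b (m - j) * floquetCoeff b μ j) /
      (((m : ℂ) + 1) * ((m : ℂ) + 1 + 2 * (μ : ℂ)))

lemma floquetCoeff_zero (b : ℕ → ℂ) (μ : ℝ) : floquetCoeff b μ 0 = 1 := by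
  rw [floquetCoeff]

lemma floquetCoeff_succ_mul (b : ℕ → ℂ) {μ : ℝ} (hμ : 0 ≤ μ) (m : ℕ) :
    (((m : ℂ) + 1) * ((m : ℂ) + 1 + 2 * (μ : ℂ))) * floquetCoeff b μ (m + 1) =
      -∑ ij ∈ Finset.HasAntidiagonal.antidiagonal m, b ij.1 * floquetCoeff b μ ij.2 := by
  have h : (((m : ℂ) + 1) * ((m : ℂ) + 1 + 2 * (μ : ℂ))) ≠ 0 := by
    have : ((m : ℝ) + 1) * ((m : ℝ) + 1 + 2 * μ) ≠ 0 := by positivity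
    exact_mod_cast this
  rw [floquetCoeff, mul_div_cancel₀ _ h,
    ← Finset.Nat.sum_antidiagonal_swap,
    Finset.Nat.sum_antidiagonal_eq_sum_range_succ_mk, Finset.sum_range]
  simp

lemma norm_floquetCoeff_succ_le (b : ℕ → ℂ) {μ : ℝ} (hμ : 0 ≤ μ) (m : ℕ) :
    ((m : ℝ) + 1) ^ 2 * ‖floquetCoeff b μ (m + 1)‖ ≤
      ∑ ij ∈ Finset.HasAntidiagonal.antidiagonal m, ‖b ij.1‖ * ‖floquetCoeff b μ ij.2‖ := by
  have hnorm : ‖(((m : ℂ) + 1) * ((m : ℂ) + 1 + 2 * (μ : ℂ)))‖ =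
      ((m : ℝ) + 1) * ((m : ℝ) + 1 + 2 * μ) := by
    have : (((m : ℂ) + 1) * ((m : ℂ) + 1 + 2 * (μ : ℂ))) =
      ((((m : ℝ) + 1) * ((m : ℝ) + 1 + 2 * μ) : ℝ) : ℂ) := by push_cast; ring
    rw [this, Complex.norm_real, Real.norm_of_nonneg (by positivity)]
  calc ((m : ℝ) + 1) ^ 2 * ‖floquetCoeff b μ (m + 1)‖
      ≤ (((m : ℝ) + 1) * ((m : ℝ) + 1 + 2 * μ)) * ‖floquetCoeff b μ (m + 1)‖ := by
        refine mul_le_mul_of_nonneg_right ?_ (norm_nonneg _)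
        nlinarith [mul_nonneg (by positivity : (0 : ℝ) ≤ (m : ℝ) + 1) hμ]
    _ = ‖∑ ij ∈ Finset.HasAntidiagonal.antidiagonal m, b ij.1 * floquetCoeff b μ ij.2‖ := by
        rw [← hnorm, ← norm_mul, floquetCoeff_succ_mul b hμ, norm_neg]
    _ ≤ _ := (norm_sum_le _ _).trans_eq (by simp)

lemma sum_antidiagonal_norm_le {b p : ℕ → ℂ} (hb : Summable fun k => ‖b k‖) {P : ℝ} {m : ℕ}
    (hP : 0 ≤ P) (hp : ∀ j ≤ m, ‖p j‖ ≤ P) :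
    ∑ ij ∈ Finset.HasAntidiagonal.antidiagonal m, ‖b ij.1‖ * ‖p ij.2‖ ≤ (∑' k, ‖b k‖) * P := by
  calc ∑ ij ∈ Finset.HasAntidiagonal.antidiagonal m, ‖b ij.1‖ * ‖p ij.2‖
      ≤ ∑ ij ∈ Finset.HasAntidiagonal.antidiagonal m, ‖b ij.1‖ * P := by
        refine Finset.sum_le_sum fun ij hij => ?_
        gcongr
        have := Finset.HasAntidiagonal.mem_antidiagonal.1 hij
        exact hp _ (by omega)
    _ = (∑ k ∈ Finset.range (m + 1), ‖b k‖) * P := by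
        rw [Finset.Nat.sum_antidiagonal_eq_sum_range_succ_mk, Finset.sum_mul]
    _ ≤ _ := by
        gcongr
        exact hb.sum_le_tsum _ fun _ _ => norm_nonneg _

lemma exists_norm_floquetCoeff_le {b : ℕ → ℂ} (hb : Summable fun k => ‖b k‖) {μ : ℝ}
    (hμ : 0 ≤ μ) : ∃ P : ℝ, 0 ≤ P ∧ ∀ k, ‖floquetCoeff b μ k‖ ≤ P := by
  obtain ⟨N, hN⟩ := exists_nat_ge (∑' k, ‖b k‖)
  have hP : 0 ≤ ∑ j ∈ Finset.range (N + 1), ‖floquetCoeff b μ j‖ := by positivity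
  refine ⟨_, hP, fun k => ?_⟩
  induction k using Nat.strong_induction_on with
  | _ k ih =>
    rcases lt_or_ge k (N + 1) with hk | hk
    · exact Finset.single_le_sum (f := fun j => ‖floquetCoeff b μ j‖)
        (fun _ _ => norm_nonneg _) (Finset.mem_range.2 hk)
    · obtain ⟨m, rfl⟩ : ∃ m, k = m + 1 := ⟨k - 1, by omega⟩
      have h1 := (norm_floquetCoeff_succ_le b hμ m).trans
        (sum_antidiagonal_norm_le hb hP fun j hj => ih j (by omega))
      have hm : (N : ℝ) ≤ m := by exact_mod_cast (by omega : N ≤ m)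
      have h2 : (∑' k, ‖b k‖) ≤ ((m : ℝ) + 1) ^ 2 := by nlinarith [Nat.cast_nonneg (α := ℝ) m]
      have h3 := h1.trans (mul_le_mul_of_nonneg_right h2 hP)
      exact le_of_mul_le_mul_left h3 (by positivity)

lemma summable_norm_floquetCoeff {b : ℕ → ℂ} (hb : Summable fun k => ‖b k‖) {μ : ℝ}
    (hμ : 0 ≤ μ) : Summable fun k => ‖floquetCoeff b μ k‖ := by
  obtain ⟨P, hP, hp⟩ := exists_norm_floquetCoeff_le hb hμ
  rw [← summable_nat_add_iff 1]
  have hs : Summable fun m : ℕ => ((∑' k, ‖b k‖) * P) * (1 / ((m + 1 : ℕ) : ℝ) ^ 2) :=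
    ((summable_nat_add_iff 1).2 (Real.summable_one_div_nat_pow.2 one_lt_two)).mul_left _
  refine hs.of_nonneg_of_le (fun _ => norm_nonneg _) fun m => ?_
  have h1 := (norm_floquetCoeff_succ_le b hμ m).trans
    (sum_antidiagonal_norm_le hb hP fun j _ => hp j)
  rw [mul_one_div, le_div_iff₀ (by positivity), mul_comm]
  exact_mod_cast h1

lemma summable_sq_mul_norm_floquetCoeff {b : ℕ → ℂ} (hb : Summable fun k => ‖b k‖) {μ : ℝ}
    (hμ : 0 ≤ μ) : Summable fun k : ℕ => (k : ℝ) ^ 2 * ‖floquetCoeff b μ k‖ := by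
  rw [← summable_nat_add_iff 1]
  refine (summable_sum_mul_antidiagonal_of_summable_mul
    (f := fun k => ‖b k‖) (g := fun k => ‖floquetCoeff b μ k‖)
    (hb.mul_of_nonneg (summable_norm_floquetCoeff hb hμ) (fun _ => norm_nonneg _)
      fun _ => norm_nonneg _)).of_nonneg_of_le (fun _ => by positivity) fun m => ?_
  simpa using norm_floquetCoeff_succ_le b hμ m

/-- The series `∑ₖ qₖ e^{i(k+μ)x}`. -/
def floquetSeries (μ : ℝ) (q : ℕ → ℂ) (x : ℝ) : ℂ :=
  ∑' k : ℕ, q k * Complex.exp (Complex.I * ((k : ℂ) + μ) * (x : ℂ))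

lemma norm_exp_I_mul_ofReal_mul (k : ℕ) (μ x : ℝ) :
    ‖Complex.exp (Complex.I * ((k : ℂ) + μ) * (x : ℂ))‖ = 1 := by
  have : Complex.I * ((k : ℂ) + μ) * (x : ℂ) = ((((k : ℝ) + μ) * x : ℝ) : ℂ) * Complex.I := by
    push_cast; ring
  rw [this, Complex.norm_exp_ofReal_mul_I]

lemma summable_norm_floquetSeries {q : ℕ → ℂ} (hq : Summable fun k => ‖q k‖) (μ x : ℝ) :
    Summable fun k : ℕ => ‖q k * Complex.exp (Complex.I * ((k : ℂ) + μ) * (x : ℂ))‖ := by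
  simpa [norm_mul, norm_exp_I_mul_ofReal_mul] using hq

lemma hasDerivAt_floquetSeries {q : ℕ → ℂ} {μ : ℝ} (hq : Summable fun k => ‖q k‖)
    (hq' : Summable fun k : ℕ => ‖Complex.I * ((k : ℂ) + μ) * q k‖) (x : ℝ) :
    HasDerivAt (floquetSeries μ q)
      (floquetSeries μ (fun k => Complex.I * ((k : ℂ) + μ) * q k) x) x := by
  have hg : ∀ (k : ℕ) (y : ℝ), HasDerivAt
      (fun y : ℝ => q k * Complex.exp (Complex.I * ((k : ℂ) + μ) * (y : ℂ)))
      (Complex.I * ((k : ℂ) + μ) * q k * Complex.exp (Complex.I * ((k : ℂ) + μ) * (y : ℂ))) y := by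
    intro k y
    have h := ((((hasDerivAt_id (y : ℂ)).const_mul
      (Complex.I * ((k : ℂ) + μ))).cexp).const_mul (q k)).comp_ofReal
    refine h.congr_deriv ?_
    rw [id]
    ring
  refine hasDerivAt_tsum hq' hg (fun k y => ?_)
    (summable_norm_floquetSeries hq μ 0).of_norm x
  rw [norm_mul, norm_exp_I_mul_ofReal_mul, mul_one]

lemma floquetSeries_add_two_pi (μ : ℝ) (q : ℕ → ℂ) (x : ℝ) :
    floquetSeries μ q (x + 2 * Real.pi) =
      Complex.exp (2 * Real.pi * μ * Complex.I) * floquetSeries μ q x := by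
  rw [floquetSeries, floquetSeries, ← tsum_mul_left]
  refine tsum_congr fun k => ?_
  have : Complex.I * ((k : ℂ) + μ) * ((x + 2 * Real.pi : ℝ) : ℂ) =
      2 * Real.pi * μ * Complex.I + Complex.I * ((k : ℂ) + μ) * (x : ℂ) +
        k * (2 * Real.pi * Complex.I) := by push_cast; ring
  rw [this, Complex.exp_add, Complex.exp_nat_mul_two_pi_mul_I, Complex.exp_add]
  ring

lemma coeff_zero_eq_zero_of_floquetSeries_eq_zero {q : ℕ → ℂ} (hq : Summable fun k => ‖q k‖)
    {μ : ℝ} (h : ∀ x, floquetSeries μ q x = 0) : q 0 = 0 := by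
  have h0 : ∀ x : ℝ, HasSum (fun k : ℕ => q k * Complex.exp (Complex.I * k * (x : ℂ))) 0 := by
    intro x
    have h1 := (summable_norm_floquetSeries hq μ x).of_norm.hasSum
    rw [← floquetSeries, h] at h1
    have h2 := h1.mul_right (Complex.exp (-(Complex.I * μ * x)))
    rw [zero_mul] at h2
    have h3 : ∀ k : ℕ, q k * Complex.exp (Complex.I * ((k : ℂ) + μ) * (x : ℂ)) *
        Complex.exp (-(Complex.I * μ * x)) = q k * Complex.exp (Complex.I * k * (x : ℂ)) := by
      intro k
      rw [mul_assoc, ← Complex.exp_add]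
      ring_nf
    simpa only [h3] using h2
  have h3 : HasSum (fun k : ℕ => ∫ x in (0 : ℝ)..2 * Real.pi,
      q k * Complex.exp (Complex.I * k * (x : ℂ))) (∫ x in (0 : ℝ)..2 * Real.pi, (0 : ℂ)) := by
    refine intervalIntegral.hasSum_integral_of_dominated_convergence (fun k _ => ‖q k‖)
      (fun k => ?_) (fun k => ?_) ?_ ?_ ?_
    · exact (by fun_prop : Continuous fun x : ℝ =>
        q k * Complex.exp (Complex.I * k * (x : ℂ))).aestronglyMeasurable
    · refine .of_forall fun x _ => ?_
      have := norm_exp_I_mul_ofReal_mul k 0 x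
      simp only [Complex.ofReal_zero, add_zero] at this
      rw [norm_mul, this, mul_one]
    · exact .of_forall fun x _ => hq
    · simp
    · exact .of_forall fun x _ => h0 x
  have h4 : ∀ k : ℕ, k ≠ 0 → ∫ x in (0 : ℝ)..2 * Real.pi,
      q k * Complex.exp (Complex.I * k * (x : ℂ)) = 0 := by
    intro k hk
    rw [intervalIntegral.integral_const_mul, integral_exp_mul_complex (by simp [hk])]
    have : Complex.I * k * ((2 * Real.pi : ℝ) : ℂ) = k * (2 * Real.pi * Complex.I) := by
      push_cast; ring
    rw [this, Complex.exp_nat_mul_two_pi_mul_I]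
    simp
  have h5 := (hasSum_single 0 h4).unique h3
  simpa [Real.pi_ne_zero] using h5

lemma isHillSolution_floquetSeries {b : ℕ → ℂ} (hb : Summable fun k => ‖b k‖) {μ : ℝ}
    (hμ : 0 ≤ μ) :
    IsHillSolution
      (fun x => ∑' k : ℕ, b k * Complex.exp (Complex.I * ((k : ℂ) + 1) * (x : ℂ)))
      ((μ : ℂ) ^ 2) (floquetSeries μ (floquetCoeff b μ)) := by
  set p := floquetCoeff b μ with hp
  have s0 : Summable fun k => ‖p k‖ := summable_norm_floquetCoeff hb hμ
  have sq : Summable fun k : ℕ => (k : ℝ) ^ 2 * ‖p k‖ := summable_sq_mul_norm_floquetCoeff hb hμ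
  have hn : ∀ k : ℕ, ‖(k : ℂ) + μ‖ = k + μ := fun k => by
    rw [← Complex.ofReal_natCast, ← Complex.ofReal_add, Complex.norm_real,
      Real.norm_of_nonneg (by positivity)]
  have s2 : Summable fun k : ℕ =>
      ‖Complex.I * ((k : ℂ) + μ) * (Complex.I * ((k : ℂ) + μ) * p k)‖ := by
    refine ((sq.mul_left 2).add (s0.mul_left (2 * μ ^ 2))).of_nonneg_of_le
      (fun _ => norm_nonneg _) fun k => ?_
    simp only [norm_mul, Complex.norm_I, one_mul, hn]
    nlinarith [mul_nonneg (sq_nonneg ((k : ℝ) - μ)) (norm_nonneg (p k))]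
  have s1 : Summable fun k : ℕ => ‖Complex.I * ((k : ℂ) + μ) * p k‖ := by
    refine (s0.add s2).of_nonneg_of_le (fun _ => norm_nonneg _) fun k => ?_
    simp only [norm_mul, Complex.norm_I, one_mul, hn]
    nlinarith [mul_nonneg (sq_nonneg ((k : ℝ) + μ - 1)) (norm_nonneg (p k)),
      mul_nonneg (by positivity : 0 ≤ (k : ℝ) + μ) (norm_nonneg (p k)), norm_nonneg (p k)]
  have d1 := hasDerivAt_floquetSeries s0 s1
  have d2 := hasDerivAt_floquetSeries s1 s2
  have e1 : deriv (floquetSeries μ p) = _ := funext fun x => (d1 x).deriv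
  refine ⟨fun x => (d1 x).differentiableAt, ?_, fun x => ?_⟩
  · rw [e1]
    exact fun x => (d2 x).differentiableAt
  have hV : Summable fun k : ℕ =>
      ‖b k * Complex.exp (Complex.I * ((k : ℂ) + 1) * (x : ℂ))‖ := by
    simpa using summable_norm_floquetSeries hb 1 x
  have hprod := tsum_mul_tsum_eq_tsum_sum_antidiagonal_of_summable_norm hV
    (summable_norm_floquetSeries s0 μ x)
  have hzero := (summable_norm_floquetSeries s0 μ x).of_norm.mul_left ((μ : ℂ) ^ 2)
  have htwo := (summable_norm_floquetSeries s2 μ x).of_norm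
  rw [e1, (d2 x).deriv]
  simp only [floquetSeries]
  rw [hprod, neg_add_eq_iff_eq_add, ← tsum_mul_left, ← htwo.tsum_add hzero,
    (htwo.add hzero).tsum_eq_zero_add]
  have hfirst : Complex.I * (((0 : ℕ) : ℂ) + μ) * (Complex.I * (((0 : ℕ) : ℂ) + μ) * p 0) *
      Complex.exp (Complex.I * (((0 : ℕ) : ℂ) + μ) * (x : ℂ)) + (μ : ℂ) ^ 2 *
        (p 0 * Complex.exp (Complex.I * (((0 : ℕ) : ℂ) + μ) * (x : ℂ))) = 0 := by
    push_cast
    linear_combination ((μ : ℂ) ^ 2 * p 0 *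
      Complex.exp (Complex.I * (0 + μ) * (x : ℂ))) * Complex.I_sq
  rw [hfirst, zero_add]
  refine tsum_congr fun m => ?_
  have hsum : ∑ ij ∈ Finset.HasAntidiagonal.antidiagonal m,
      b ij.1 * Complex.exp (Complex.I * ((ij.1 : ℂ) + 1) * (x : ℂ)) *
        (p ij.2 * Complex.exp (Complex.I * ((ij.2 : ℂ) + μ) * (x : ℂ))) =
      (∑ ij ∈ Finset.HasAntidiagonal.antidiagonal m, b ij.1 * p ij.2) *
        Complex.exp (Complex.I * (((m + 1 : ℕ) : ℂ) + μ) * (x : ℂ)) := by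
    rw [Finset.sum_mul]
    refine Finset.sum_congr rfl fun ij hij => ?_
    have : Complex.I * (((m + 1 : ℕ) : ℂ) + μ) * (x : ℂ) =
        Complex.I * ((ij.1 : ℂ) + 1) * (x : ℂ) + Complex.I * ((ij.2 : ℂ) + μ) * (x : ℂ) := by
      rw [← Finset.HasAntidiagonal.mem_antidiagonal.1 hij]
      push_cast
      ring
    rw [this, Complex.exp_add]
    ring
  have hrec := floquetCoeff_succ_mul b hμ m
  rw [← hp] at hrec
  rw [hsum, ← neg_eq_iff_eq_neg.2 hrec]
  push_cast
  linear_combination (-((m : ℂ) + 1 + μ) ^ 2 * p (m + 1) *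
      Complex.exp (Complex.I * ((m : ℂ) + 1 + μ) * (x : ℂ))) * Complex.I_sq

lemma IsHillSolution.wronskian_eq {V : ℝ → ℂ} {z : ℂ} {f g : ℝ → ℂ}
    (hf : IsHillSolution V z f) (hg : IsHillSolution V z g) (x : ℝ) :
    f x * deriv g x - deriv f x * g x = f 0 * deriv g 0 - deriv f 0 * g 0 := by
  obtain ⟨hf1, hf2, hf3⟩ := hf
  obtain ⟨hg1, hg2, hg3⟩ := hg
  have hd : ∀ y, HasDerivAt (fun y => f y * deriv g y - deriv f y * g y) 0 y := fun y => by
    have h := ((hf1 y).hasDerivAt.mul (hg2 y).hasDerivAt).sub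
      ((hf2 y).hasDerivAt.mul (hg1 y).hasDerivAt)
    refine h.congr_deriv ?_
    linear_combination g y * hf3 y - f y * hg3 y
  exact is_const_of_deriv_eq_zero (fun y => (hd y).differentiableAt) (fun y => (hd y).deriv) x 0

/-- For `V(x) = ∑_{k=1}^∞ a_k e^{ikx}` with `∑|a_k| < ∞`, `n ≥ 3` and every `ε ∈ [0,1]`,
the Floquet discriminant of `εV` at `1/n²` equals `2 cos(2π/n)`; in particular (taking
`ε = 1`) `Δ(V;1/n²) = 2 cos(2π/n)`. -/
theorem discriminant_eps_V_eq_two_cos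
    (a : ℕ → ℂ) (ha : Summable fun k => ‖a k‖)
    (V : ℝ → ℂ)
    (hV : ∀ x : ℝ, V x = ∑' k : ℕ, a k * Complex.exp (Complex.I * ((k : ℂ) + 1) * (x : ℂ)))
    (n : ℕ) (hn : 3 ≤ n)
    (ε : ℝ) (hε : ε ∈ Set.Icc (0 : ℝ) 1)
    (c s : ℝ → ℂ)
    (hc : IsHillSolution (fun x => (ε : ℂ) * V x) (1 / (n : ℂ) ^ 2) c)
    (hc0 : c 0 = 1) (hc0' : deriv c 0 = 0)
    (hs : IsHillSolution (fun x => (ε : ℂ) * V x) (1 / (n : ℂ) ^ 2) s)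
    (hs0 : s 0 = 0) (hs0' : deriv s 0 = 1) :
    c (2 * Real.pi) + deriv s (2 * Real.pi) =
      ((2 * Real.cos (2 * Real.pi / (n : ℝ)) : ℝ) : ℂ) := by
  have hμ : (0 : ℝ) ≤ 1 / n := by positivity
  set μ : ℝ := 1 / n with hμdef
  have hb : Summable fun k => ‖(ε : ℂ) * a k‖ := by
    simpa [norm_mul] using ha.mul_left |ε|
  set ψ := floquetSeries μ (floquetCoeff (fun k => (ε : ℂ) * a k) μ)
  have hψ : IsHillSolution (fun x => (ε : ℂ) * V x) (1 / (n : ℂ) ^ 2) ψ := by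
    have h := isHillSolution_floquetSeries hb hμ
    have hz : ((μ : ℝ) : ℂ) ^ 2 = 1 / (n : ℂ) ^ 2 := by
      rw [hμdef]
      push_cast
      ring
    rw [hz] at h
    convert h using 2 with x
    rw [hV, ← tsum_mul_left]
    simp only [mul_assoc]
  set lam : ℂ := Complex.exp (2 * Real.pi * μ * Complex.I) with hlam
  have hper : ∀ x, ψ (x + 2 * Real.pi) = lam * ψ x := floquetSeries_add_two_pi _ _
  have hper' : ∀ x, deriv ψ (x + 2 * Real.pi) = lam * deriv ψ x := fun x => by
    rw [← deriv_comp_add_const, funext hper, deriv_const_mul _ (hψ.1 x)]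
  have hcs := fun x => hc.wronskian_eq hs x
  have hψs := fun x => hψ.wronskian_eq hs x
  have hcψ := fun x => hc.wronskian_eq hψ x
  simp only [hc0, hc0', hs0, hs0', mul_one, mul_zero, zero_mul, sub_zero, one_mul]
    at hcs hψs hcψ
  have hrep : ∀ x, ψ x = ψ 0 * c x + deriv ψ 0 * s x := fun x => by
    linear_combination (-ψ x) * hcs x + c x * hψs x + s x * hcψ x
  have hrep' : ∀ x, deriv ψ x = ψ 0 * deriv c x + deriv ψ 0 * deriv s x := fun x => by
    linear_combination (-deriv ψ x) * hcs x + deriv c x * hψs x + deriv s x * hcψ x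
  have hne : ¬(ψ 0 = 0 ∧ deriv ψ 0 = 0) := by
    rintro ⟨h0, h0'⟩
    have h := coeff_zero_eq_zero_of_floquetSeries_eq_zero (summable_norm_floquetCoeff hb hμ)
      (μ := μ) fun x => (hrep x).trans (by rw [h0, h0']; ring)
    rw [floquetCoeff_zero] at h
    exact one_ne_zero h
  have hA : ψ 0 * c (2 * Real.pi) + deriv ψ 0 * s (2 * Real.pi) = lam * ψ 0 := by
    rw [← hrep, ← hper, zero_add]
  have hB : ψ 0 * deriv c (2 * Real.pi) + deriv ψ 0 * deriv s (2 * Real.pi) =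
      lam * deriv ψ 0 := by
    rw [← hrep', ← hper', zero_add]
  have hdet := hcs (2 * Real.pi)
  have hchar : lam ^ 2 - (c (2 * Real.pi) + deriv s (2 * Real.pi)) * lam + 1 = 0 := by
    by_cases h0 : ψ 0 = 0
    · refine (mul_eq_zero.1 ?_).resolve_left fun h => hne ⟨h0, h⟩
      linear_combination (c (2 * Real.pi) - lam) * hB - deriv c (2 * Real.pi) * hA -
        deriv ψ 0 * hdet
    · refine (mul_eq_zero.1 ?_).resolve_left h0
      linear_combination (deriv s (2 * Real.pi) - lam) * hA - s (2 * Real.pi) * hB -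
        ψ 0 * hdet
  have hlam0 : lam ≠ 0 := Complex.exp_ne_zero _
  have hcos : ((2 * Real.cos (2 * Real.pi / (n : ℝ)) : ℝ) : ℂ) = lam + lam⁻¹ := by
    have h : (2 * Real.pi * μ * Complex.I : ℂ) =
        ((2 * Real.pi / n : ℝ) : ℂ) * Complex.I := by
      rw [hμdef]
      push_cast
      ring
    rw [hlam, h, ← Complex.exp_neg, Complex.ofReal_mul, Complex.ofReal_cos, Complex.ofReal_ofNat,
      Complex.two_cos, neg_mul]
  rw [hcos]
  field_simp
  linear_combination -hchar
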